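/- arXiv:1310.3352 — 2 statements merged into one kernel-verified Lean document; each statement's English description precedes it below -/
import Mathlib

section
/- Let Ψ(t) = t·log log log(e^{e^e}+t) and fix p ∈ (1,∞). Then for all sufficiently small ε ∈ (0, p-1), the constant C_{Ψ^{p-ε}}(p) = (∫₁^∞ Ψ(t)^{p-ε}/t^p · dt/t)^{1/p} is comparable to ε^{-1/p} · log log(e^e + 1/ε), with implied constants depending only on p. -/
open MeasureTheory ENNReal Set
noncomputable section

abbrev Rn (n : ℕ) := Fin n → ℝ

/-- Axis-parallel cube with center `c` and half-sidelength `r`. -/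
def cube (n : ℕ) (c : Rn n) (r : ℝ) : Set (Rn n) := {y | ∀ i, |y i - c i| ≤ r}

/-- Hardy–Littlewood maximal operator over cubes (ℝ≥0∞-valued input). -/
def Mop (n : ℕ) (f : Rn n → ℝ≥0∞) (x : Rn n) : ℝ≥0∞ :=
  ⨆ (c : Rn n) (r : ℝ) (_ : 0 < r) (_ : x ∈ cube n c r),
    (volume (cube n c r))⁻¹ * ∫⁻ y in cube n c r, f y

/-- Hardy–Littlewood maximal operator of a real function. -/
def MopR (n : ℕ) (f : Rn n → ℝ) (x : Rn n) : ℝ≥0∞ :=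
  Mop n (fun y => ENNReal.ofReal |f y|) x

/-- Muckenhoupt `A_p` constant. -/
def ApConst (n : ℕ) (p : ℝ) (w : Rn n → ℝ) : ℝ≥0∞ :=
  ⨆ (c : Rn n) (r : ℝ) (_ : 0 < r),
    ((volume (cube n c r))⁻¹ * ∫⁻ y in cube n c r, ENNReal.ofReal (w y)) *
      ((volume (cube n c r))⁻¹ *
        ∫⁻ y in cube n c r, (ENNReal.ofReal (w y)) ^ (-(1 / (p - 1)))) ^ (p - 1)

/-- Muckenhoupt `A_1` constant. -/
def A1Const (n : ℕ) (w : Rn n → ℝ) : ℝ≥0∞ :=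
  ⨆ (c : Rn n) (r : ℝ) (_ : 0 < r),
    ((volume (cube n c r))⁻¹ * ∫⁻ y in cube n c r, ENNReal.ofReal (w y)) *
      (essInf (fun y => ENNReal.ofReal (w y)) (volume.restrict (cube n c r)))⁻¹

/-- Fujii–Wilson `A_∞` constant. -/
def AinfConst (n : ℕ) (w : Rn n → ℝ) : ℝ≥0∞ :=
  ⨆ (c : Rn n) (r : ℝ) (_ : 0 < r),
    (∫⁻ y in cube n c r, ENNReal.ofReal (w y))⁻¹ *
      ∫⁻ x in cube n c r, Mop n ((cube n c r).indicator (fun y => ENNReal.ofReal (w y))) x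

/-- Young function predicate. -/
def IsYoung (Φ : ℝ → ℝ) : Prop :=
  ContinuousOn Φ (Ici 0) ∧ ConvexOn ℝ (Ici 0) Φ ∧ MonotoneOn Φ (Ici 0) ∧
    Φ 0 = 0 ∧ Filter.Tendsto Φ Filter.atTop Filter.atTop

/-- Mean Luxemburg norm of `f` on `Q`. -/
def luxNorm {n : ℕ} (Φ : ℝ → ℝ) (f : Rn n → ℝ) (Q : Set (Rn n)) : ℝ :=
  sInf {l : ℝ | 0 < l ∧
    (volume Q)⁻¹ * (∫⁻ x in Q, ENNReal.ofReal (Φ (|f x| / l))) ≤ 1}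

/-- Weighted mean Luxemburg norm of `f` on `Q`. -/
def wLuxNorm {n : ℕ} (Φ : ℝ → ℝ) (w f : Rn n → ℝ) (Q : Set (Rn n)) : ℝ :=
  sInf {l : ℝ | 0 < l ∧
    (∫⁻ x in Q, ENNReal.ofReal (w x))⁻¹ *
      (∫⁻ x in Q, ENNReal.ofReal (Φ (|f x| / l)) * ENNReal.ofReal (w x)) ≤ 1}

/-- Orlicz maximal function `M_Φ`. -/
def MOrlicz (n : ℕ) (Φ : ℝ → ℝ) (f : Rn n → ℝ) (x : Rn n) : ℝ≥0∞ :=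
  ⨆ (c : Rn n) (r : ℝ) (_ : 0 < r) (_ : x ∈ cube n c r),
    ENNReal.ofReal (luxNorm Φ f (cube n c r))

/-- `B_p` constant of a Young function, ℝ≥0∞-valued. -/
def BpConst (Φ : ℝ → ℝ) (p : ℝ) : ℝ≥0∞ :=
  (∫⁻ t in Ioi (1 : ℝ), ENNReal.ofReal (Φ t / t ^ (p + 1))) ^ (1 / p)

/-- `B_p` constant of a Young function, real-valued. -/
def BpConstR (Φ : ℝ → ℝ) (p : ℝ) : ℝ :=
  (∫ t in Ioi (1 : ℝ), Φ t / t ^ (p + 1)) ^ (1 / p)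

/-- Weighted `L^p` "norm" of an ℝ≥0∞-valued function. -/
def wLp (n : ℕ) (p : ℝ) (f : Rn n → ℝ≥0∞) (w : Rn n → ℝ) : ℝ≥0∞ :=
  (∫⁻ x, (f x) ^ p * ENNReal.ofReal (w x)) ^ (1 / p)

/-- Sparse family of sets. -/
def IsSparse (n : ℕ) (S : Set (Set (Rn n))) : Prop :=
  ∃ E : Set (Rn n) → Set (Rn n),
    (∀ Q ∈ S, E Q ⊆ Q ∧ MeasurableSet (E Q) ∧ volume Q ≤ 2 * volume (E Q)) ∧
    S.PairwiseDisjoint E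

/-- Non-increasing rearrangement of `g` restricted to `Q`, evaluated at `t`. -/
def rearr {n : ℕ} (g : Rn n → ℝ) (Q : Set (Rn n)) (t : ℝ≥0∞) : ℝ :=
  sInf {s : ℝ | 0 ≤ s ∧ volume {x ∈ Q | s < |g x|} ≤ t}

/-- Local mean oscillation `ω_λ(f;Q)`. -/
def osc {n : ℕ} (lam : ℝ) (f : Rn n → ℝ) (Q : Set (Rn n)) : ℝ :=
  ⨅ c : ℝ, rearr (fun x => f x - c) Q (ENNReal.ofReal lam * volume Q)

/-- The dyadic lattice generated by the cube with center `c`, half-side `r`. -/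
def dyadicSub (n : ℕ) (c : Rn n) (r : ℝ) : Set (Set (Rn n)) :=
  {Q | ∃ (k : ℕ) (j : Fin n → ℕ), (∀ i, j i < 2 ^ k) ∧
    Q = cube n (fun i => c i - r + (2 * (j i : ℝ) + 1) * (r / 2 ^ k)) (r / 2 ^ k)}

/-- `m` is a median value of `f` on `Q`. -/
def IsMedian {n : ℕ} (f : Rn n → ℝ) (Q : Set (Rn n)) (m : ℝ) : Prop :=
  volume {x ∈ Q | m < f x} ≤ volume Q / 2 ∧ volume {x ∈ Q | f x < m} ≤ volume Q / 2

open Real in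
lemma aux_LX {X : ℝ} (hX : exp (exp 1) ≤ X) : exp 1 ≤ Real.log X ∧ 1 ≤ Real.log (Real.log X) ∧ 0 < X ∧ Real.log (Real.log X) ≤ X := by
  have h0 : 0 < X := lt_of_lt_of_le (exp_pos _) hX
  have h1 : exp 1 ≤ Real.log X := (le_log_iff_exp_le h0).2 hX
  have h1' : 0 < Real.log X := lt_of_lt_of_le (exp_pos _) h1
  have h2 : 1 ≤ Real.log (Real.log X) := (le_log_iff_exp_le h1').2 h1
  refine ⟨h1, h2, h0, ?_⟩
  have := log_le_sub_one_of_pos h0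
  have := log_le_sub_one_of_pos h1'
  linarith

open Real in
lemma aux_exp1 : 2 < exp 1 := by
  have := Real.exp_one_gt_d9
  linarith

open Real in
lemma aux_up {ε t : ℝ} (hε : 0 < ε) (ht : 1 < t) :
    Real.log (Real.log (Real.log (exp (exp (exp 1)) + t))) ≤
      2 * Real.log (Real.log (exp (exp 1) + 1 / ε)) * (1 + ε * Real.log t) := by
  set X := exp (exp 1) + 1 / ε with hXdef
  have hX : exp (exp 1) ≤ X := by have : 0 < 1 / ε := by positivity
                                  linarith
  obtain ⟨h1, h2, h0, -⟩ := aux_LX hX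
  have he := aux_exp1
  set a := exp (exp (exp 1)) with ha
  have ha1 : 2 ≤ a := by
    have := add_one_le_exp (exp (exp 1))
    have := add_one_le_exp (exp 1)
    linarith
  have hlt : 0 < Real.log t := log_pos ht
  set s := ε * Real.log t with hs
  have hs0 : 0 < s := by positivity
  have hlogt : Real.log t = s / ε := by rw [hs]; field_simp
  have hat : exp (exp 1) ≤ Real.log (a + t) := by
    rw [le_log_iff_exp_le (by linarith)]; linarith
  obtain ⟨g1, g2, g0, -⟩ := aux_LX hat
  have s1 : Real.log (a + t) ≤ X * (2 * (1 + s)) := by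
    have : a + t ≤ a ^ 2 * t ^ 2 := by
      have : a + t ≤ 2 * (a * t) := by nlinarith
      have : 2 ≤ a * t := by nlinarith
      nlinarith
    have h3 : Real.log (a + t) ≤ Real.log (a ^ 2 * t ^ 2) := log_le_log (by linarith) this
    rw [log_mul (by positivity) (by positivity), Real.log_pow, Real.log_pow, ha, log_exp, hlogt] at h3
    refine h3.trans ?_
    rw [hXdef]
    have : 0 < exp (exp 1) * s := by positivity
    have : 0 < 1 / ε := by positivity
    have e : s / ε = 1 / ε * s := by ring
    push_cast
    nlinarith
  set u := 2 * (1 + s) with hu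
  have hu1 : 1 ≤ u := by linarith
  have hlu : 0 ≤ Real.log u := log_nonneg hu1
  have s2 : Real.log (Real.log (a + t)) ≤ Real.log X * (1 + Real.log u) := by
    have := log_le_log (by linarith) s1
    rw [log_mul (by positivity) (by positivity)] at this
    nlinarith
  have s3 : Real.log (Real.log (Real.log (a + t))) ≤ Real.log (Real.log X) + Real.log (1 + Real.log u) := by
    have := log_le_log (by linarith) s2
    rwa [log_mul (by linarith) (by linarith)] at this
  have s4 := log_le_sub_one_of_pos (show 0 < 1 + Real.log u by linarith)
  have s5 := log_le_sub_one_of_pos (show 0 < u by linarith)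
  nlinarith

open Real in
lemma aux_low {ε t : ℝ} (hε : 0 < ε) (ht : exp (1 / ε) < t) :
    (1 - Real.log 2) * Real.log (Real.log (exp (exp 1) + 1 / ε)) ≤
    Real.log (Real.log (Real.log (exp (exp (exp 1)) + t))) := by
  set X := exp (exp 1) + 1 / ε with hXdef
  have hε1 : 0 < 1 / ε := by positivity
  have hX : exp (exp 1) ≤ X := by linarith
  obtain ⟨h1, h2, h0, -⟩ := aux_LX hX
  have he := aux_exp1
  have hl2 : Real.log 2 < 1 := by have := Real.log_two_lt_d9; linarith
  have hl2' : 0 < Real.log 2 := log_pos (by norm_num)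
  set a := exp (exp (exp 1)) with ha
  have ha0 : 0 < a := exp_pos _
  have ht0 : 0 < t := (exp_pos _).trans ht
  have q1 : exp (exp 1) ≤ Real.log (a + t) := by
    rw [le_log_iff_exp_le (by linarith)]; linarith
  have q2 : 1 / ε ≤ Real.log (a + t) := by
    rw [le_log_iff_exp_le (by linarith)]; linarith
  have s1 : X / 2 ≤ Real.log (a + t) := by linarith
  have s2 : Real.log X / 2 ≤ Real.log (Real.log (a + t)) := by
    have := log_le_log (by linarith) s1
    rw [log_div (by positivity) (by norm_num)] at this
    linarith
  have s3 : Real.log (Real.log X) - Real.log 2 ≤ Real.log (Real.log (Real.log (a + t))) := by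
    have := log_le_log (by linarith) s2
    rwa [log_div (by linarith) (by norm_num)] at this
  nlinarith

open Real in
lemma aux_F {p ε t L : ℝ} (ht : 0 < t) (hL : 0 ≤ L) :
    (t * L) ^ (p - ε) / t ^ (p + 1) = t ^ (-1 - ε) * L ^ (p - ε) := by
  rw [mul_rpow ht.le hL, show (-1 - ε) = (p - ε) - (p + 1) by ring, rpow_sub ht (p - ε) (p + 1)]
  ring

open Real in
lemma aux_L1 {t : ℝ} (ht : 0 < t) : 1 ≤ Real.log (Real.log (Real.log (exp (exp (exp 1)) + t))) := by
  refine (aux_LX (X := Real.log (exp (exp (exp 1)) + t)) ?_).2.1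
  rw [le_log_iff_exp_le (by positivity)]; linarith

open Real in
lemma aux_ptup {p ε t A L : ℝ} (hp : 1 < p) (hε : 0 < ε) (hεp : ε < p - 1) (ht : 1 < t)
    (hA : 1 ≤ A) (hL : 1 ≤ L) (h : L ≤ 2 * A * (1 + ε * Real.log t)) :
    t ^ (-1 - ε) * L ^ (p - ε) ≤ (4 * p * A) ^ p * t ^ (-1 - ε / 2) := by
  have ht0 : 0 < t := by linarith
  have hlt : 0 < Real.log t := log_pos ht
  have h1 : L ^ (p - ε) ≤ L ^ p := rpow_le_rpow_of_exponent_le hL (by linarith)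
  have h2 : L ≤ (4 * p * A) * t ^ (ε / (2 * p)) := by
    have e1 := add_one_le_exp (Real.log t * (ε / (2 * p)))
    rw [← rpow_def_of_pos ht0] at e1
    have e2 : 1 + ε * Real.log t ≤ 2 * p * t ^ (ε / (2 * p)) := by
      have := mul_le_mul_of_nonneg_left e1 (show 0 ≤ 2 * p by linarith)
      have e3 : 2 * p * (Real.log t * (ε / (2 * p)) + 1) = ε * Real.log t + 2 * p := by field_simp
      linarith
    have := mul_le_mul_of_nonneg_left e2 (show 0 ≤ 2 * A by linarith)
    linarith
  have h3 : L ^ p ≤ (4 * p * A) ^ p * t ^ (ε / 2) := by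
    have := rpow_le_rpow (by linarith) h2 (show 0 ≤ p by linarith)
    rwa [mul_rpow (by positivity) (by positivity), ← rpow_mul ht0.le,
      show ε / (2 * p) * p = ε / 2 by field_simp] at this
  calc _ ≤ t ^ (-1 - ε) * ((4 * p * A) ^ p * t ^ (ε / 2)) := by
        gcongr; exact h1.trans h3
    _ = (4 * p * A) ^ p * (t ^ (-1 - ε) * t ^ (ε / 2)) := by ring
    _ = _ := by rw [← rpow_add ht0]; ring_nf

open Real in
lemma aux_ptlow {p ε A X L c : ℝ} (hp : 1 < p) (hε : 0 < ε) (hεp : ε < p - 1)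
    (hA : 1 ≤ A) (hAX : A ≤ X) (hX : X = exp (exp 1) + 1 / ε) (hc : 0 < c) (hc1 : c ≤ 1)
    (h : c * A ≤ L) :
    (c * A) ^ p * exp (-(p * exp (exp 1) + 1)) ≤ L ^ (p - ε) := by
  have hA0 : 0 < A := by linarith
  have h1 : (c * A) ^ (p - ε) ≤ L ^ (p - ε) := rpow_le_rpow (by positivity) h (by linarith)
  refine le_trans ?_ h1
  rw [rpow_sub (by positivity), div_eq_mul_inv, exp_neg]
  gcongr
  rw [rpow_def_of_pos (by positivity)]
  gcongr
  have h2 := log_le_sub_one_of_pos (show 0 < c * A by positivity)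
  have h3 : Real.log (c * A) ≤ X := by nlinarith
  have h4 : Real.log (c * A) * ε ≤ X * ε := by gcongr
  have h5 : X * ε = exp (exp 1) * ε + 1 := by rw [hX]; field_simp
  have := exp_pos (exp 1)
  nlinarith

/-- For `Ψ(t) = t logloglog(e^{e^e}+t)` and fixed `p ∈ (1,∞)`, for all
sufficiently small `ε ∈ (0, p-1)`, `C_{Ψ^{p-ε}}(p) ≃ ε^{-1/p} loglog(e^e + 1/ε)`,
with constants depending only on `p`. -/
theorem stmt2 (p : ℝ) (hp : 1 < p) :
    ∃ c₁ c₂ ε₀ : ℝ, 0 < c₁ ∧ 0 < c₂ ∧ 0 < ε₀ ∧ ε₀ ≤ p - 1 ∧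
    ∀ ε : ℝ, 0 < ε → ε < ε₀ →
      c₁ * (ε ^ (-(1 / p)) * Real.log (Real.log (Real.exp (Real.exp 1) + 1 / ε))) ≤
        BpConstR (fun t => (t *
          Real.log (Real.log (Real.log (Real.exp (Real.exp (Real.exp 1)) + t)))) ^ (p - ε)) p ∧
      BpConstR (fun t => (t *
          Real.log (Real.log (Real.log (Real.exp (Real.exp (Real.exp 1)) + t)))) ^ (p - ε)) p ≤
        c₂ * (ε ^ (-(1 / p)) * Real.log (Real.log (Real.exp (Real.exp 1) + 1 / ε))) := by
  set K := Real.exp (-(p * Real.exp (Real.exp 1) + 1)) with hK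
  have hK0 : 0 < K := Real.exp_pos _
  have hl2 : 0 < 1 - Real.log 2 := by have := Real.log_two_lt_d9; linarith
  have hl2' : 0 < Real.log 2 := Real.log_pos (by norm_num)
  set c := 1 - Real.log 2 with hc
  have hp0 : 0 < p := by linarith
  have root : ∀ x : ℝ, 0 ≤ x → (x ^ p) ^ (1 / p) = x := fun x hx => by
    rw [← Real.rpow_mul hx, mul_one_div_cancel hp0.ne', Real.rpow_one]
  refine ⟨c * (K * Real.exp (-1)) ^ (1 / p), 4 * p * 2 ^ (1 / p), p - 1, by positivity,
    by positivity, by linarith, le_rfl, fun ε hε hεp => ?_⟩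
  have hε1 : 0 < 1 / ε := by positivity
  obtain ⟨-, hA, -, hAX⟩ := aux_LX (X := Real.exp (Real.exp 1) + 1 / ε) (by linarith)
  set A := Real.log (Real.log (Real.exp (Real.exp 1) + 1 / ε)) with hAdef
  have hA0 : 0 < A := by linarith
  unfold BpConstR
  set F : ℝ → ℝ := fun t => (t *
          Real.log (Real.log (Real.log (Real.exp (Real.exp (Real.exp 1)) + t)))) ^ (p - ε)
          / t ^ (p + 1) with hF
  have hFm : Measurable F := by
    rw [hF]; fun_prop
  have hFeq : ∀ t : ℝ, 0 < t → F t = t ^ (-1 - ε) *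
      Real.log (Real.log (Real.log (Real.exp (Real.exp (Real.exp 1)) + t))) ^ (p - ε) :=
    fun t ht => aux_F ht (by linarith [aux_L1 ht])
  have hF0 : ∀ t : ℝ, 0 < t → 0 ≤ F t := fun t ht => by
    have := aux_L1 ht
    rw [hFeq t ht]; positivity
  have hup : ∀ t ∈ Ioi (1:ℝ), F t ≤ (4 * p * A) ^ p * t ^ (-1 - ε / 2) := fun t ht => by
    have ht' : (1:ℝ) < t := ht
    rw [hFeq t (by linarith)]
    exact aux_ptup hp hε hεp ht' hA (aux_L1 (by linarith)) (aux_up hε ht')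
  have hGi : IntegrableOn (fun t : ℝ => (4 * p * A) ^ p * t ^ (-1 - ε / 2)) (Ioi 1) :=
    (integrableOn_Ioi_rpow_of_lt (by linarith) one_pos).const_mul _
  have hFi : IntegrableOn F (Ioi 1) := by
    refine Integrable.mono' hGi hFm.aestronglyMeasurable ?_
    filter_upwards [ae_restrict_mem measurableSet_Ioi] with t ht
    have ht' : (1:ℝ) < t := ht
    rw [Real.norm_of_nonneg (hF0 t (by linarith))]
    exact hup t ht
  have hI0 : 0 ≤ ∫ t in Ioi (1:ℝ), F t :=
    setIntegral_nonneg measurableSet_Ioi fun t ht => hF0 t (by linarith [show (1:ℝ) < t from ht])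
  have hIup : ∫ t in Ioi (1:ℝ), F t ≤ (4 * p * A) ^ p * (2 * ε⁻¹) := by
    refine (setIntegral_mono_on hFi hGi measurableSet_Ioi hup).trans ?_
    rw [integral_const_mul, integral_Ioi_rpow_of_lt (by linarith) one_pos, Real.one_rpow,
      show -1 - ε / 2 + 1 = -(ε / 2) by ring, neg_div_neg_eq, one_div_div, div_eq_mul_inv]
  have hT : (1:ℝ) < Real.exp (1 / ε) := Real.one_lt_exp_iff.2 hε1
  have hIlow : (c * A) ^ p * K * Real.exp (-1) * ε⁻¹ ≤ ∫ t in Ioi (1:ℝ), F t := by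
    have hsub : Ioi (Real.exp (1 / ε)) ⊆ Ioi (1:ℝ) := Ioi_subset_Ioi hT.le
    have m1 : ∫ t in Ioi (Real.exp (1 / ε)), F t ≤ ∫ t in Ioi (1:ℝ), F t := by
      refine setIntegral_mono_set hFi ?_ hsub.eventuallyLE
      filter_upwards [ae_restrict_mem measurableSet_Ioi] with t ht
      exact hF0 t (by linarith [show (1:ℝ) < t from ht])
    refine le_trans ?_ m1
    have m2 : ∫ t in Ioi (Real.exp (1 / ε)), (c * A) ^ p * K * t ^ (-1 - ε) ≤
        ∫ t in Ioi (Real.exp (1 / ε)), F t := by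
      refine setIntegral_mono_on
        ((integrableOn_Ioi_rpow_of_lt (by linarith) (by linarith)).const_mul _)
        (hFi.mono_set hsub) measurableSet_Ioi fun t ht => ?_
      have ht0 : 0 < t := by linarith [show Real.exp (1 / ε) < t from ht]
      rw [hFeq t ht0, mul_comm]
      gcongr
      exact aux_ptlow hp hε hεp hA hAX rfl hl2 (by linarith) (aux_low hε ht)
    refine le_trans (le_of_eq ?_) m2
    rw [integral_const_mul, integral_Ioi_rpow_of_lt (by linarith) (by linarith),
      show -1 - ε + 1 = -ε by ring, neg_div_neg_eq, ← Real.exp_mul,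
      show 1 / ε * -ε = -1 by field_simp, div_eq_mul_inv, mul_assoc]
  have hεr : ε ^ (-(1 / p)) = (ε⁻¹) ^ (1 / p) := by
    rw [Real.rpow_neg hε.le, Real.inv_rpow hε.le]
  constructor
  · refine le_trans (le_of_eq ?_)
      (Real.rpow_le_rpow (by positivity) hIlow (by positivity : 0 ≤ 1 / p))
    have e : (c * A) ^ p * K * Real.exp (-1) * ε⁻¹ =
      (c * A) ^ p * ((K * Real.exp (-1)) * ε⁻¹) := by ring
    rw [e, Real.mul_rpow (x := (c * A) ^ p) (by positivity) (by positivity),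
      Real.mul_rpow (y := ε⁻¹) (by positivity) (by positivity), root _ (by positivity), hεr]
    ring
  · refine (Real.rpow_le_rpow hI0 hIup (by positivity : 0 ≤ 1 / p)).trans (le_of_eq ?_)
    rw [Real.mul_rpow (x := (4 * p * A) ^ p) (by positivity) (by positivity),
      Real.mul_rpow (y := ε⁻¹) (by positivity) (by positivity), root _ (by positivity), hεr]
    ring
end
end

section
/- Let w be a weight on ℝⁿ with [w]_{A₁} < ∞, and set r = 1 + 1/(2^{n+1}[w]_{A₁}). Then M_r w(x) ≤ 2[w]_{A₁} w(x) for almost every x, where M_r w = (M(w^r))^{1/r} and M is the Hardy–Littlewood maximal operator over cubes. -/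
open MeasureTheory ENNReal Set
noncomputable section

lemma cube_eq (n : ℕ) (c : Rn n) {ρ : ℝ} (hρ : 0 ≤ ρ) : cube n c ρ = Metric.closedBall c ρ := by
  ext y
  simp [cube, Metric.mem_closedBall, dist_pi_le_iff hρ, Real.dist_eq]

lemma vol_cube (n : ℕ) (c : Rn n) {ρ : ℝ} (hρ : 0 ≤ ρ) :
    volume (cube n c ρ) = ENNReal.ofReal ((2 * ρ) ^ n) := by
  rw [cube_eq n c hρ, Real.volume_pi_closedBall c hρ]; simp

lemma volr_cube (n : ℕ) (c : Rn n) {ρ : ℝ} (hρ : 0 ≤ ρ) :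
    volume.real (cube n c ρ) = (2 * ρ) ^ n := by
  rw [Measure.real, vol_cube n c hρ, ENNReal.toReal_ofReal (by positivity)]

lemma meas_cube (n : ℕ) (c : Rn n) {ρ : ℝ} (hρ : 0 ≤ ρ) : MeasurableSet (cube n c ρ) := by
  rw [cube_eq n c hρ]; exact Metric.isClosed_closedBall.measurableSet

lemma int_cube {n : ℕ} {w : Rn n → ℝ} (hwi : LocallyIntegrable w volume) (c : Rn n) {ρ : ℝ}
    (hρ : 0 ≤ ρ) : IntegrableOn w (cube n c ρ) := by
  rw [cube_eq n c hρ]; exact hwi.integrableOn_isCompact (isCompact_closedBall c ρ)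

/-- average on a cube -/
def av {n : ℕ} (w : Rn n → ℝ) (c : Rn n) (ρ : ℝ) : ℝ := ⨍ y in cube n c ρ, w y

lemma av_mul {n : ℕ} (w : Rn n → ℝ) (c : Rn n) {ρ : ℝ} (hρ : 0 < ρ) :
    (2 * ρ) ^ n * av w c ρ = ∫ y in cube n c ρ, w y := by
  rw [av, setAverage_eq, volr_cube n c hρ.le, smul_eq_mul]
  have : (2 * ρ) ^ n ≠ 0 := by positivity
  field_simp

lemma av_nonneg {n : ℕ} {w : Rn n → ℝ} (hw : ∀ x, 0 ≤ w x) (c : Rn n) {ρ : ℝ} (hρ : 0 < ρ) :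
    0 ≤ av w c ρ := by
  have h : 0 ≤ (2 * ρ) ^ n * av w c ρ := by
    rw [av_mul w c hρ]; exact integral_nonneg hw
  exact nonneg_of_mul_nonneg_right h (by positivity)

def sg {n : ℕ} (c x : Rn n) : Fin n → Bool := fun i => decide (c i ≤ x i)

def child {n : ℕ} (c : Rn n) (ρ : ℝ) (σ : Fin n → Bool) : Rn n :=
  fun i => c i + (if σ i then ρ / 2 else -(ρ / 2))

lemma mem_child {n : ℕ} {c x : Rn n} {ρ : ℝ} (hx : x ∈ cube n c ρ) :
    x ∈ cube n (child c ρ (sg c x)) (ρ / 2) := by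
  intro i
  have := abs_le.1 (hx i)
  rw [abs_le]
  by_cases h : c i ≤ x i
  · simp only [child, sg, h, decide_true, if_true]; constructor <;> linarith
  · simp [child, sg, h]; push Not at h; constructor <;> linarith

lemma child_sub {n : ℕ} {c : Rn n} {ρ : ℝ} (σ : Fin n → Bool) :
    cube n (child c ρ σ) (ρ / 2) ⊆ cube n c ρ := by
  intro x hx i
  have := abs_le.1 (hx i)
  rw [abs_le]
  by_cases h : σ i
  · simp [child, h] at this; constructor <;> linarith
  · simp [child, h] at this; constructor <;> linarith

lemma iUnion_child {n : ℕ} (c : Rn n) (ρ : ℝ) :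
    ⋃ σ, cube n (child c ρ σ) (ρ / 2) = cube n c ρ := by
  apply subset_antisymm
  · exact iUnion_subset fun σ => child_sub σ
  · intro x hx; exact mem_iUnion.2 ⟨_, mem_child hx⟩

lemma disj_child {n : ℕ} (c : Rn n) (ρ : ℝ) :
    Pairwise (Function.onFun (AEDisjoint volume) (fun σ => cube n (child c ρ σ) (ρ / 2))) := by
  intro σ τ h
  obtain ⟨i, hi⟩ := Function.ne_iff.1 h
  have h0 : volume {x : Rn n | x i = c i} = 0 :=
    Measure.pi_hyperplane (fun _ : Fin n => (volume : Measure ℝ)) i (c i)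
  refine measure_mono_null ?_ h0
  rintro x ⟨h1, h2⟩
  have h1 := abs_le.1 (h1 i)
  have h2 := abs_le.1 (h2 i)
  show x i = c i
  cases hs : σ i <;> cases ht : τ i <;> simp [child, hs, ht] at h1 h2 hi <;> linarith

lemma sum_av {n : ℕ} {w : Rn n → ℝ} (hwi : LocallyIntegrable w volume) (c : Rn n) {ρ : ℝ}
    (hρ : 0 < ρ) : ∑ σ, (2 * (ρ / 2)) ^ n * av w (child c ρ σ) (ρ / 2) = (2 * ρ) ^ n * av w c ρ := by
  have hρ2 : 0 < ρ / 2 := by positivity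
  simp_rw [av_mul w _ hρ2]
  rw [av_mul w c hρ, ← iUnion_child c ρ, integral_iUnion_ae
    (fun σ => (meas_cube n _ hρ2.le).nullMeasurableSet) (disj_child c ρ)
    (by rw [iUnion_child]; exact int_cube hwi c hρ.le), tsum_fintype]

lemma av_child_le {n : ℕ} {w : Rn n → ℝ} (hw : ∀ x, 0 ≤ w x)
    (hwi : LocallyIntegrable w volume) (c : Rn n) {ρ : ℝ}
    (hρ : 0 < ρ) (σ : Fin n → Bool) : av w (child c ρ σ) (ρ / 2) ≤ 2 ^ n * av w c ρ := by
  have hρ2 : 0 < ρ / 2 := by positivity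
  have h : (2 * (ρ / 2)) ^ n * av w (child c ρ σ) (ρ / 2) ≤ (2 * ρ) ^ n * av w c ρ := by
    rw [av_mul w _ hρ2, av_mul w _ hρ]
    exact setIntegral_mono_set (int_cube hwi c hρ.le) (ae_of_all _ hw)
      (child_sub σ).eventuallyLE
  rw [show 2 * (ρ / 2) = ρ by ring, mul_pow] at h
  have : 0 < ρ ^ n := by positivity
  nlinarith

lemma key (ε K a b : ℝ) (hε : 0 < ε) (ha : 0 ≤ a) (hab : a ≤ b) (hK : b ≤ K * a) :
    b ^ ε * b - K * ε * (b ^ ε * b) ≤ a ^ ε * b - K * ε * (a ^ ε * a) := by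
  rcases ha.eq_or_lt with rfl | ha
  · have : b = 0 := by linarith
    simp [this]
  have hb : 0 < b := ha.trans_le hab
  have hae : 0 < a ^ ε := Real.rpow_pos_of_pos ha _
  have hbe : 0 < b ^ ε := Real.rpow_pos_of_pos hb _
  have hm : a ^ ε ≤ b ^ ε := Real.rpow_le_rpow ha.le hab hε.le
  have hK0 : 0 < K := by
    by_contra h
    nlinarith
  have h1 := Real.log_le_sub_one_of_pos (div_pos hae hbe)
  have h2 := Real.log_le_sub_one_of_pos (div_pos hb ha)
  rw [Real.log_div hae.ne' hbe.ne', Real.log_rpow ha, Real.log_rpow hb] at h1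
  rw [Real.log_div hb.ne' ha.ne'] at h2
  have h3 : 1 - a ^ ε / b ^ ε ≤ ε * (b / a - 1) := by nlinarith
  have h4 : (b ^ ε - a ^ ε) * a ≤ ε * (b - a) * b ^ ε := by
    have := mul_le_mul_of_nonneg_right h3 (mul_pos hbe ha).le
    field_simp at this
    linarith
  have h5 : (b ^ ε - a ^ ε) * b ≤ (b ^ ε - a ^ ε) * (K * a) :=
    mul_le_mul_of_nonneg_left hK (by linarith)
  have h6 : K * ((b ^ ε - a ^ ε) * a) ≤ K * (ε * (b - a) * b ^ ε) :=
    mul_le_mul_of_nonneg_left h4 hK0.le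
  have h7 : K * ε * (a * a ^ ε) ≤ K * ε * (a * b ^ ε) := by gcongr
  nlinarith

/-- dyadic averages -/
def E {n : ℕ} (w : Rn n → ℝ) : ℕ → Rn n → ℝ → Rn n → ℝ
  | 0, c, ρ, _ => av w c ρ
  | k + 1, c, ρ, x => E w k (child c ρ (sg c x)) (ρ / 2) x

lemma meas_E {n : ℕ} (w : Rn n → ℝ) (k : ℕ) : ∀ c ρ, Measurable (E w k c ρ) := by
  induction k with
  | zero => intro c ρ; exact measurable_const
  | succ k ih =>
    intro c ρ
    have h1 : Measurable (fun p : Rn n × (Fin n → Bool) => E w k (child c ρ p.2) (ρ / 2) p.1) :=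
      measurable_from_prod_countable_left fun σ => ih (child c ρ σ) (ρ / 2)
    have h2 : Measurable (fun x : Rn n => sg c x) := by
      refine measurable_pi_lambda _ fun i => ?_
      have : MeasurableSet {x : Rn n | c i ≤ x i} :=
        measurableSet_le measurable_const (measurable_pi_apply i)
      refine measurable_to_bool ?_
      convert this using 1
      ext x; simp [sg]
    exact h1.comp (measurable_id.prodMk h2)

lemma E_spec {n : ℕ} (w : Rn n → ℝ) (k : ℕ) : ∀ c ρ x, x ∈ cube n c ρ →
    ∃ d, E w k c ρ x = av w d (ρ / 2 ^ k) ∧ x ∈ cube n d (ρ / 2 ^ k) := by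
  induction k with
  | zero => intro c ρ x hx; exact ⟨c, by simp [E], by simpa using hx⟩
  | succ k ih =>
    intro c ρ x hx
    obtain ⟨d, h1, h2⟩ := ih _ _ x (mem_child hx)
    rw [div_div, ← pow_succ'] at h1 h2
    exact ⟨d, h1, h2⟩

lemma E_nonneg {n : ℕ} {w : Rn n → ℝ} (hw : ∀ x, 0 ≤ w x) (k : ℕ) : ∀ c ρ x, 0 < ρ →
    0 ≤ E w k c ρ x := by
  induction k with
  | zero => intro c ρ x hρ; exact av_nonneg hw c hρ
  | succ k ih => intro c ρ x hρ; exact ih _ _ x (by positivity)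

lemma E_tendsto {n : ℕ} {w : Rn n → ℝ} (hwi : LocallyIntegrable w volume) :
    ∀ᵐ x : Rn n, ∀ c ρ, 0 < ρ → x ∈ cube n c ρ →
      Filter.Tendsto (fun k => E w k c ρ x) Filter.atTop (nhds (w x)) := by
  filter_upwards [IsUnifLocDoublingMeasure.ae_tendsto_average volume hwi 1] with x hx c ρ hρ hxc
  choose d h1 h2 using fun k => E_spec w k c ρ x hxc
  have hpos : ∀ k : ℕ, 0 < ρ / 2 ^ k := fun k => by positivity
  have h3 := @hx ℕ Filter.atTop d (fun k => ρ / 2 ^ k) ?_ ?_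
  · refine h3.congr fun k => ?_
    rw [h1, av, cube_eq n _ (hpos k).le]
  · refine tendsto_nhdsWithin_iff.2 ⟨?_, Filter.Eventually.of_forall hpos⟩
    have := (tendsto_pow_atTop_nhds_zero_of_lt_one (r := (1/2 : ℝ)) (by norm_num)
      (by norm_num)).const_mul ρ
    simpa [div_eq_mul_inv] using this
  · refine Filter.Eventually.of_forall fun k => ?_
    have := h2 k
    rwa [cube_eq n _ (hpos k).le, ← one_mul (ρ / 2 ^ k)] at this

lemma bellman {n : ℕ} {w : Rn n → ℝ} (hw : ∀ x, 0 ≤ w x)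
    (hwi : LocallyIntegrable w volume) (A : ℝ) (hA : 0 < A)
    (h1 : ∀ c ρ, 0 < ρ → ∀ᵐ x ∂(volume.restrict (cube n c ρ)), av w c ρ ≤ A * w x)
    (ε : ℝ) (hε : 0 < ε) (hεA : 2 ^ n * ε * A ≤ 1 / 2) (k : ℕ) :
    ∀ c ρ a, 0 < ρ → av w c ρ ≤ a → (∀ᵐ x ∂(volume.restrict (cube n c ρ)), a ≤ A * w x) →
      ∫⁻ x in cube n c ρ, ENNReal.ofReal (E w k c ρ x ^ ε * w x) ≤
        ENNReal.ofReal (2 * (2 * ρ) ^ n *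
          (a ^ ε * av w c ρ - 2 ^ n * ε * (a ^ ε * a))) := by
  induction k with
  | zero =>
    intro c ρ a hρ ha haw
    have hs := av_nonneg hw c hρ
    have ha0 : 0 ≤ a := hs.trans ha
    have haA : a ≤ A * av w c ρ := by
      have hi : ∫ x in cube n c ρ, a ≤ ∫ x in cube n c ρ, A * w x := by
        refine integral_mono_ae ?_ ((int_cube hwi c hρ.le).const_mul A) haw
        refine integrableOn_const ?_
        rw [vol_cube n c hρ.le]; exact ofReal_ne_top
      rw [integral_const_mul, ← av_mul w c hρ, setIntegral_const, volr_cube n c hρ.le,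
        smul_eq_mul] at hi
      have : 0 < (2 * ρ) ^ n := by positivity
      nlinarith
    have hae : 0 ≤ a ^ ε := Real.rpow_nonneg ha0 _
    simp only [E]
    rw [← ofReal_integral_eq_lintegral_ofReal ((int_cube hwi c hρ.le).const_mul _)
      (ae_of_all _ fun x => mul_nonneg (Real.rpow_nonneg hs _) (hw x)), integral_const_mul,
      ← av_mul w c hρ]
    apply ENNReal.ofReal_le_ofReal
    have h2 : av w c ρ ^ ε * av w c ρ ≤ a ^ ε * av w c ρ := by gcongr
    have h3 : 2 ^ n * ε * a ≤ av w c ρ / 2 := by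
      have : 2 ^ n * ε * a ≤ 2 ^ n * ε * (A * av w c ρ) := by gcongr
      nlinarith
    have h4 := mul_le_mul_of_nonneg_left h3 hae
    have h5 : av w c ρ ^ ε * av w c ρ ≤
      2 * (a ^ ε * av w c ρ - 2 ^ n * ε * (a ^ ε * a)) := by nlinarith
    have h6 := mul_le_mul_of_nonneg_left h5 (show 0 ≤ (2 * ρ) ^ n by positivity)
    nlinarith
  | succ k ih =>
    intro c ρ a hρ ha haw
    have hρ2 : 0 < ρ / 2 := by positivity
    have hs := av_nonneg hw c hρ
    have ha0 : 0 ≤ a := hs.trans ha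
    have hae : 0 ≤ a ^ ε := Real.rpow_nonneg ha0 _
    have hsg : ∀ σ, MeasurableSet {x : Rn n | sg c x = σ} := by
      intro σ
      have : {x : Rn n | sg c x = σ} = ⋂ i, {x : Rn n | sg c x i = σ i} := by
        ext x; simp [funext_iff]
      rw [this]
      refine MeasurableSet.iInter fun i => ?_
      have h0 : MeasurableSet {x : Rn n | c i ≤ x i} :=
        measurableSet_le measurable_const (measurable_pi_apply i)
      cases σ i
      · convert h0.compl using 1
        ext x; simp [sg]
      · convert h0 using 1
        ext x; simp [sg]
    have hcov : cube n c ρ ⊆ ⋃ σ, (cube n (child c ρ σ) (ρ / 2) ∩ {x | sg c x = σ}) := by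
      intro x hx
      exact mem_iUnion.2 ⟨sg c x, mem_child hx, rfl⟩
    have hK : (0 : ℝ) < 2 ^ n := by positivity
    have hstep : ∀ σ, ∫⁻ x in cube n (child c ρ σ) (ρ / 2) ∩ {x | sg c x = σ},
          ENNReal.ofReal (E w (k + 1) c ρ x ^ ε * w x) ≤
        ENNReal.ofReal (2 * (2 * (ρ / 2)) ^ n *
          (a ^ ε * av w (child c ρ σ) (ρ / 2) - 2 ^ n * ε * (a ^ ε * a))) := by
      intro σ
      have e1 : ∫⁻ x in cube n (child c ρ σ) (ρ / 2) ∩ {x | sg c x = σ},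
          ENNReal.ofReal (E w (k + 1) c ρ x ^ ε * w x) =
          ∫⁻ x in cube n (child c ρ σ) (ρ / 2) ∩ {x | sg c x = σ},
          ENNReal.ofReal (E w k (child c ρ σ) (ρ / 2) x ^ ε * w x) := by
        refine setLIntegral_congr_fun ((meas_cube n _ hρ2.le).inter (hsg σ)) ?_
        rintro x ⟨_, hx⟩
        have hx : sg c x = σ := hx
        simp [E, hx]
      rw [e1]
      refine (lintegral_mono_set inter_subset_left).trans ?_
      have haw' := ae_restrict_of_ae_restrict_of_subset (child_sub (c := c) (ρ := ρ) σ) haw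
      have hc := av_child_le hw hwi c hρ σ
      rcases le_total (av w (child c ρ σ) (ρ / 2)) a with h | h
      · exact ih _ _ a hρ2 h haw'
      · refine (ih _ _ _ hρ2 le_rfl (h1 _ _ hρ2)).trans (ENNReal.ofReal_le_ofReal ?_)
        have := key ε (2 ^ n) a _ hε ha0 h (hc.trans (by gcongr))
        gcongr
    have hnn : ∀ σ : Fin n → Bool, 0 ≤ 2 * (2 * (ρ / 2)) ^ n *
          (a ^ ε * av w (child c ρ σ) (ρ / 2) - 2 ^ n * ε * (a ^ ε * a)) := by
      intro σ
      have haA : a ≤ A * av w (child c ρ σ) (ρ / 2) := by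
        have haw' := ae_restrict_of_ae_restrict_of_subset (child_sub (c := c) (ρ := ρ) σ) haw
        have hi : ∫ x in cube n (child c ρ σ) (ρ / 2), a ≤
            ∫ x in cube n (child c ρ σ) (ρ / 2), A * w x := by
          refine integral_mono_ae ?_ ((int_cube hwi _ hρ2.le).const_mul A) haw'
          refine integrableOn_const ?_
          rw [vol_cube n _ hρ2.le]; exact ofReal_ne_top
        rw [integral_const_mul, ← av_mul w _ hρ2, setIntegral_const, volr_cube n _ hρ2.le,
          smul_eq_mul] at hi
        have : 0 < (2 * (ρ / 2)) ^ n := by positivity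
        nlinarith
      have hs' := av_nonneg hw (child c ρ σ) hρ2
      have h3 : 2 ^ n * ε * a ≤ av w (child c ρ σ) (ρ / 2) := by
        have : 2 ^ n * ε * a ≤ 2 ^ n * ε * (A * av w (child c ρ σ) (ρ / 2)) := by gcongr
        nlinarith
      have h4 := mul_le_mul_of_nonneg_left h3 hae
      refine mul_nonneg (by positivity) ?_
      linarith
    calc _ ≤ ∫⁻ x in ⋃ σ, (cube n (child c ρ σ) (ρ / 2) ∩ {x | sg c x = σ}),
          ENNReal.ofReal (E w (k + 1) c ρ x ^ ε * w x) := lintegral_mono_set hcov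
      _ ≤ ∑' σ, ∫⁻ x in (cube n (child c ρ σ) (ρ / 2) ∩ {x | sg c x = σ}),
          ENNReal.ofReal (E w (k + 1) c ρ x ^ ε * w x) := lintegral_iUnion_le _ _
      _ ≤ ∑' σ : Fin n → Bool, ENNReal.ofReal (2 * (2 * (ρ / 2)) ^ n *
          (a ^ ε * av w (child c ρ σ) (ρ / 2) - 2 ^ n * ε * (a ^ ε * a))) :=
            ENNReal.tsum_le_tsum hstep
      _ = ENNReal.ofReal (∑ σ : Fin n → Bool, 2 * (2 * (ρ / 2)) ^ n *
          (a ^ ε * av w (child c ρ σ) (ρ / 2) - 2 ^ n * ε * (a ^ ε * a))) := by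
            rw [tsum_fintype, ENNReal.ofReal_sum_of_nonneg fun σ _ => hnn σ]
      _ = _ := by
        congr 1
        have e : ∀ σ : Fin n → Bool, 2 * (2 * (ρ / 2)) ^ n *
          (a ^ ε * av w (child c ρ σ) (ρ / 2) - 2 ^ n * ε * (a ^ ε * a)) =
          2 * a ^ ε * ((2 * (ρ / 2)) ^ n * av w (child c ρ σ) (ρ / 2)) -
          2 * ρ ^ n * (2 ^ n * ε * (a ^ ε * a)) := by
            intro σ
            rw [show 2 * (ρ / 2) = ρ by ring]; ring
        simp_rw [e]
        rw [Finset.sum_sub_distrib, ← Finset.mul_sum, sum_av hwi c hρ]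
        simp only [Finset.sum_const, Finset.card_univ, Fintype.card_pi, Fintype.card_bool,
          Finset.prod_const, Fintype.card_fin, nsmul_eq_mul]
        push_cast
        rw [mul_pow]; ring

lemma revHolder {n : ℕ} {w : Rn n → ℝ} (hw : ∀ x, 0 ≤ w x)
    (hwi : LocallyIntegrable w volume) (A : ℝ) (hA : 0 < A)
    (h1 : ∀ c ρ, 0 < ρ → ∀ᵐ x ∂(volume.restrict (cube n c ρ)), av w c ρ ≤ A * w x)
    (ε : ℝ) (hε : 0 < ε) (hεA : 2 ^ n * ε * A ≤ 1 / 2) (c : Rn n) (ρ : ℝ) (hρ : 0 < ρ) :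
    ∫⁻ x in cube n c ρ, ENNReal.ofReal (w x ^ ε * w x) ≤
        ENNReal.ofReal (2 * (2 * ρ) ^ n * (av w c ρ ^ ε * av w c ρ)) := by
  have hs := av_nonneg hw c hρ
  have hb : ∀ k, ∫⁻ x in cube n c ρ, ENNReal.ofReal (E w k c ρ x ^ ε * w x) ≤
        ENNReal.ofReal (2 * (2 * ρ) ^ n * (av w c ρ ^ ε * av w c ρ)) := by
    intro k
    refine (bellman hw hwi A hA h1 ε hε hεA k c ρ _ hρ le_rfl (h1 c ρ hρ)).trans ?_
    apply ENNReal.ofReal_le_ofReal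
    have : 0 ≤ 2 ^ n * ε * (av w c ρ ^ ε * av w c ρ) := by positivity
    gcongr
    linarith
  have hwm : AEMeasurable w (volume.restrict (cube n c ρ)) :=
    (int_cube hwi c hρ.le).aemeasurable
  calc _ = ∫⁻ x in cube n c ρ, Filter.liminf
        (fun k => ENNReal.ofReal (E w k c ρ x ^ ε * w x)) Filter.atTop := by
        refine lintegral_congr_ae ?_
        filter_upwards [ae_restrict_of_ae (E_tendsto hwi),
          ae_restrict_mem (meas_cube n c hρ.le)] with x hx hxc
        refine (Filter.Tendsto.liminf_eq ?_).symm
        refine ENNReal.tendsto_ofReal (Filter.Tendsto.mul_const _ ?_)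
        exact (hx c ρ hρ hxc).rpow_const (Or.inr hε.le)
    _ ≤ Filter.liminf (fun k => ∫⁻ x in cube n c ρ,
        ENNReal.ofReal (E w k c ρ x ^ ε * w x)) Filter.atTop := by
        refine lintegral_liminf_le' fun k => ?_
        exact ((((meas_E w k c ρ).pow_const ε).aemeasurable).mul hwm).ennreal_ofReal
    _ ≤ _ := by
        refine Filter.liminf_le_of_le (by isBoundedDefault) fun b hbb => ?_
        obtain ⟨k, hk⟩ := hbb.exists
        exact hk.trans (hb k)

lemma avg_eq {n : ℕ} {w : Rn n → ℝ} (hw : ∀ x, 0 ≤ w x)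
    (hwi : LocallyIntegrable w volume) (c : Rn n) {ρ : ℝ} (hρ : 0 < ρ) :
    (volume (cube n c ρ))⁻¹ * ∫⁻ y in cube n c ρ, ENNReal.ofReal (w y) =
      ENNReal.ofReal (av w c ρ) := by
  have hp : 0 < (2 * ρ) ^ n := by positivity
  rw [← ofReal_integral_eq_lintegral_ofReal (int_cube hwi c hρ.le) (ae_of_all _ hw),
    ← av_mul w c hρ, ENNReal.ofReal_mul hp.le, vol_cube n c hρ.le, ← mul_assoc,
    ENNReal.inv_mul_cancel (by simpa using hp) ofReal_ne_top, one_mul]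

lemma a1_ae {n : ℕ} {w : Rn n → ℝ} (hw : ∀ x, 0 ≤ w x)
    (hwi : LocallyIntegrable w volume) (hA : A1Const n w < ∞) (c : Rn n) (ρ : ℝ) (hρ : 0 < ρ) :
    ∀ᵐ x ∂(volume.restrict (cube n c ρ)), av w c ρ ≤ (A1Const n w).toReal * w x := by
  have h0 : ((volume (cube n c ρ))⁻¹ * ∫⁻ y in cube n c ρ, ENNReal.ofReal (w y)) *
      (essInf (fun y => ENNReal.ofReal (w y)) (volume.restrict (cube n c ρ)))⁻¹ ≤
      A1Const n w := by
    unfold A1Const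
    exact le_iSup_of_le c (le_iSup_of_le ρ (le_iSup_of_le hρ le_rfl))
  rw [avg_eq hw hwi c hρ] at h0
  filter_upwards [ae_essInf_le (μ := volume.restrict (cube n c ρ))
    (f := fun y => ENNReal.ofReal (w y))] with x hx
  have h1 : ENNReal.ofReal (av w c ρ) * (ENNReal.ofReal (w x))⁻¹ ≤ A1Const n w :=
    le_trans (by gcongr) h0
  rw [← div_eq_mul_inv, ENNReal.div_le_iff_le_mul (Or.inr hA.ne) (Or.inl ofReal_ne_top)] at h1
  rw [← ENNReal.ofReal_toReal hA.ne, ← ENNReal.ofReal_mul toReal_nonneg] at h1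
  exact (ENNReal.ofReal_le_ofReal_iff (mul_nonneg toReal_nonneg (hw x))).1 h1

lemma rh_ae {n : ℕ} {w : Rn n → ℝ} (hw : ∀ x, 0 ≤ w x)
    (hwi : LocallyIntegrable w volume) (hA : A1Const n w < ∞)
    (r : ℝ) (hr : r = 1 + 1 / ((2 : ℝ) ^ (n + 1) * (A1Const n w).toReal))
    (c : Rn n) (ρ : ℝ) (hρ : 0 < ρ) :
    ∀ᵐ x ∂(volume.restrict (cube n c ρ)), ∫⁻ y in cube n c ρ, ENNReal.ofReal (w y) ^ r ≤
      ENNReal.ofReal ((2 * ρ) ^ n) * (2 * A1Const n w * ENNReal.ofReal (w x)) ^ r := by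
  have hs := av_nonneg hw c hρ
  have h1 := a1_ae hw hwi hA
  set A := (A1Const n w).toReal with hAd
  have hA0 : 0 ≤ A := toReal_nonneg
  have hr1 : 1 ≤ r := by rw [hr]; simp; positivity
  have hrp : ∀ t : ℝ, 0 ≤ t → t ^ r = t ^ (r - 1) * t := by
    intro t ht
    rw [← Real.rpow_add_one' ht (by linarith)]; ring_nf
  have main : ∫⁻ y in cube n c ρ, ENNReal.ofReal (w y ^ r) ≤
      ENNReal.ofReal (2 * (2 * ρ) ^ n * (av w c ρ ^ r)) := by
    rcases hA0.eq_or_lt with h | h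
    · have : r = 1 := by rw [hr, ← h]; simp
      simp only [this, Real.rpow_one]
      rw [← ofReal_integral_eq_lintegral_ofReal (int_cube hwi c hρ.le) (ae_of_all _ hw),
        ← av_mul w c hρ]
      apply ENNReal.ofReal_le_ofReal
      have : 0 ≤ (2 * ρ) ^ n * av w c ρ := by positivity
      linarith
    · simp_rw [hrp _ (hw _)]
      rw [hrp _ hs]
      refine revHolder hw hwi A h h1 (r - 1) ?_ ?_ c ρ hρ
      · rw [hr]; simp; positivity
      · rw [hr, pow_succ]
        have : (2 : ℝ) ^ n ≠ 0 := by positivity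
        field_simp
        norm_num
  filter_upwards [h1 c ρ hρ] with x hx
  have hAw : 0 ≤ A * w x := mul_nonneg hA0 (hw x)
  have e1 : 2 * A1Const n w * ENNReal.ofReal (w x) = ENNReal.ofReal (2 * (A * w x)) := by
    rw [ENNReal.ofReal_mul (by norm_num), ENNReal.ofReal_mul hA0, hAd,
      ENNReal.ofReal_toReal hA.ne, mul_assoc]
    simp
  simp_rw [ENNReal.ofReal_rpow_of_nonneg (hw _) (by linarith : 0 ≤ r)]
  rw [e1, ENNReal.ofReal_rpow_of_nonneg (by positivity) (by linarith),
    ← ENNReal.ofReal_mul (by positivity)]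
  refine main.trans (ENNReal.ofReal_le_ofReal ?_)
  have h2 : (2 : ℝ) ≤ 2 ^ r := by
    simpa using Real.rpow_le_rpow_of_exponent_le (by norm_num : (1 : ℝ) ≤ 2) hr1
  have h3 : av w c ρ ^ r ≤ (A * w x) ^ r := Real.rpow_le_rpow hs hx (by linarith)
  rw [Real.mul_rpow (by norm_num) hAw]
  have h4 : 2 * av w c ρ ^ r ≤ 2 ^ r * (A * w x) ^ r := by gcongr
  have := mul_le_mul_of_nonneg_left h4 (show 0 ≤ (2 * ρ) ^ n by positivity)
  linarith


/-- Sharp reverse Hölder for `A₁` weights: if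
`r = 1 + 1/(2^{n+1}[w]_{A₁})`, then `M_r w ≤ 2[w]_{A₁} w` a.e. -/
theorem stmt4 (n : ℕ) (w : Rn n → ℝ) (hw : ∀ x, 0 ≤ w x)
    (hwi : LocallyIntegrable w volume) (hA : A1Const n w < ∞)
    (r : ℝ) (hr : r = 1 + 1 / ((2 : ℝ) ^ (n + 1) * (A1Const n w).toReal)) :
    ∀ᵐ x : Rn n,
      (Mop n (fun y => ENNReal.ofReal (w y) ^ r) x) ^ r⁻¹ ≤
        2 * A1Const n w * ENNReal.ofReal (w x) := by
  have hr1 : 1 ≤ r := by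
    have : 0 ≤ (A1Const n w).toReal := toReal_nonneg
    rw [hr]; simp
  have hall : ∀ᵐ x : Rn n, ∀ (q : Fin n → ℚ) (p : ℚ), (0 : ℝ) < p →
      x ∈ cube n (fun i => (q i : ℝ)) p →
      ∫⁻ y in cube n (fun i => (q i : ℝ)) p, ENNReal.ofReal (w y) ^ r ≤
      ENNReal.ofReal ((2 * (p : ℝ)) ^ n) * (2 * A1Const n w * ENNReal.ofReal (w x)) ^ r := by
    rw [ae_all_iff]; intro q
    rw [ae_all_iff]; intro p
    by_cases hp : (0 : ℝ) < p
    · have := (ae_restrict_iff' (meas_cube n _ hp.le)).1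
        (rh_ae hw hwi hA r hr (fun i => (q i : ℝ)) p hp)
      filter_upwards [this] with x hx _ using hx
    · exact ae_of_all _ fun x h => absurd h hp
  filter_upwards [hall] with x hx
  rw [ENNReal.rpow_inv_le_iff (by linarith)]
  set T := (2 * A1Const n w * ENNReal.ofReal (w x)) ^ r with hT
  have hTf : T ≠ ∞ := ENNReal.rpow_ne_top_of_nonneg (by linarith)
    (ENNReal.mul_ne_top (ENNReal.mul_ne_top (by simp) hA.ne) ofReal_ne_top)
  refine iSup_le fun c => iSup_le fun ρ => iSup_le fun hρ => iSup_le fun hxc => ?_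
  have hbd : ∀ δ : ℝ, 0 < δ → ∫⁻ y in cube n c ρ, ENNReal.ofReal (w y) ^ r ≤
      ENNReal.ofReal ((2 * (ρ + 2 * δ)) ^ n) * T := by
    intro δ hδ
    choose q hq1 hq2 using fun i => exists_rat_btwn (show c i - δ < c i by linarith)
    obtain ⟨p, hp1, hp2⟩ := exists_rat_btwn (show ρ + δ < ρ + 2 * δ by linarith)
    have hp : (0 : ℝ) < p := by linarith
    have hsub : cube n c ρ ⊆ cube n (fun i => (q i : ℝ)) p := by
      intro y hy i
      have h1 := abs_le.1 (hy i)
      have h2 := hq1 i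
      have h3 := hq2 i
      rw [abs_le]; constructor <;> linarith
    refine (lintegral_mono_set hsub).trans ((hx q p hp (hsub hxc)).trans ?_)
    gcongr
  have hlim : ∫⁻ y in cube n c ρ, ENNReal.ofReal (w y) ^ r ≤
      ENNReal.ofReal ((2 * ρ) ^ n) * T := by
    have ht : Filter.Tendsto (fun δ : ℝ => ENNReal.ofReal ((2 * (ρ + 2 * δ)) ^ n) * T)
        (nhdsWithin 0 (Ioi 0)) (nhds (ENNReal.ofReal ((2 * (ρ + 2 * 0)) ^ n) * T)) := by
      refine ENNReal.Tendsto.mul_const (ENNReal.tendsto_ofReal ?_) (Or.inr hTf)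
      have : Continuous fun δ : ℝ => (2 * (ρ + 2 * δ)) ^ n := by fun_prop
      exact (this.tendsto 0).mono_left nhdsWithin_le_nhds
    rw [mul_zero, add_zero] at ht
    exact ge_of_tendsto ht (eventually_nhdsWithin_of_forall fun δ hδ => hbd δ hδ)
  have hp : 0 < (2 * ρ) ^ n := by positivity
  rw [vol_cube n c hρ.le, mul_comm, ← div_eq_mul_inv]
  refine ENNReal.div_le_of_le_mul ?_
  rwa [mul_comm]
end
end
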